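/- arXiv:1611.09198 — 5 statements merged into one kernel-verified Lean document; each statement's English description precedes it below -/
import Mathlib

section
/- Let A and C be finite multisets of complex numbers, let w be a complex number satisfying Re(w + α) > 1 for every α ∈ A and Re(w + γ) > 1 for every γ ∈ C, and let r be a positive integer. Then (∑_{n=1}^{∞} I_{A,C}(nr) n^{-w}) · ∏_{p | r} (∑_{j=0}^{∞} I_{A,C}(p^j) p^{-jw}) = (∏_{α∈A} ζ(w+α) / ∏_{γ∈C} ζ(w+γ)) · ∏_{p | r} (∑_{j=0}^{∞} I_{A,C}(p^{j+v_p(r)}) p^{-jw}), where the products run over the prime divisors p of r, v_p(r) denotes the p-adic valuation of r, ζ is the Riemann zeta function, and all series converge absolutely. -/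
open scoped BigOperators

noncomputable def zetaShift (α : ℂ) : ArithmeticFunction ℂ :=
  ⟨fun n => if n = 0 then 0 else (n : ℂ) ^ (-α), by simp⟩

noncomputable def muShift (γ : ℂ) : ArithmeticFunction ℂ :=
  ⟨fun n => if n = 0 then 0 else (ArithmeticFunction.moebius n : ℂ) * (n : ℂ) ^ (-γ), by simp⟩

/-- `Ifun A C` : Dirichlet convolution of `n ↦ n^{-α}` over `α ∈ A` and
`n ↦ μ(n) n^{-γ}` over `γ ∈ C`; it has Dirichlet series `∏_{α∈A} ζ(s+α) / ∏_{γ∈C} ζ(s+γ)`. -/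
noncomputable def Ifun (A C : Multiset ℂ) : ArithmeticFunction ℂ :=
  (A.map zetaShift).prod * (C.map muShift).prod

open Complex LSeries.notation

namespace ArithmeticFunction

section EulerFactors

variable {R : Type*} [NormedCommRing R] [CompleteSpace R] {f : ArithmeticFunction R}

lemma injective_prime_pow_mul {p : ℕ} (hp : p.Prime) :
    Function.Injective fun x : ℕ × {u : ℕ // ¬ p ∣ u} => p ^ x.1 * (x.2 : ℕ) := by
  rintro ⟨i, u, hu⟩ ⟨j, v, hv⟩ h
  have fac (k t : ℕ) (ht : ¬ p ∣ t) : (p ^ k * t).factorization p = k := by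
    rw [Nat.factorization_mul (pow_ne_zero _ hp.ne_zero) (by rintro rfl; simp at ht)]
    simp [hp.factorization, Nat.factorization_eq_zero_of_not_dvd ht]
  have hij : i = j := by
    rw [← fac i u hu, ← fac j v hv]
    exact congrArg (fun n => n.factorization p) h
  subst hij
  have huv : u = v := Nat.eq_of_mul_eq_mul_left (pow_pos hp.pos i) h
  subst huv
  rfl

/-- Splitting off the `p`-part of the summation variable. -/
lemma IsMultiplicative.tsum_mul_prime_pow_mul (hf : f.IsMultiplicative)
    (hsum : Summable fun n => ‖f n‖) {p m : ℕ} (hp : p.Prime) (hpm : ¬ p ∣ m) (k : ℕ) :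
    ∑' n, f (n * (p ^ k * m)) =
      (∑' j, f (p ^ (j + k))) * ∑' u : {u : ℕ // ¬ p ∣ u}, f (u * m) := by
  have hm : m ≠ 0 := by rintro rfl; simp at hpm
  have h₁ : Summable fun j => ‖f (p ^ (j + k))‖ :=
    hsum.comp_injective ((Nat.pow_right_injective hp.two_le).comp (add_left_injective k))
  have h₂ : Summable fun u : {u : ℕ // ¬ p ∣ u} => ‖f (u * m)‖ :=
    hsum.comp_injective ((mul_left_injective₀ hm).comp Subtype.val_injective)
  rw [tsum_mul_tsum_of_summable_norm h₁ h₂, ← (injective_prime_pow_mul hp).tsum_eq]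
  · refine tsum_congr fun ⟨j, u, hu⟩ => ?_
    have hcop : (p ^ (j + k)).Coprime (u * m) :=
      Nat.Coprime.pow_left _ ((hp.coprime_iff_not_dvd).2 (hp.not_dvd_mul hu hpm))
    rw [← hf.map_mul_of_coprime hcop]
    congr 1
    ring
  · intro n hn
    have hn0 : n ≠ 0 := by rintro rfl; simp at hn
    obtain ⟨j, u, hu, rfl⟩ := Nat.exists_eq_pow_mul_and_not_dvd hn0 p hp.ne_one
    exact ⟨⟨j, u, hu⟩, rfl⟩

/-- For a multiplicative function, restricting an absolutely convergent sum to multiples of `r`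
changes only the Euler factors at the primes dividing `r`. -/
theorem IsMultiplicative.tsum_mul_prod_primeFactors (hf : f.IsMultiplicative)
    (hsum : Summable fun n => ‖f n‖) {r : ℕ} (hr : r ≠ 0) :
    (∑' n, f (n * r)) * ∏ p ∈ r.primeFactors, ∑' j, f (p ^ j) =
      (∑' n, f n) * ∏ p ∈ r.primeFactors, ∑' j, f (p ^ (j + r.factorization p)) := by
  induction r using Nat.recOnPrimePow with
  | zero => exact absurd rfl hr
  | one => simp
  | prime_pow_mul m p k hp hpm hk ih =>
    have hm : m ≠ 0 := by rintro rfl; simp at hpm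
    have hpf : p ∉ m.primeFactors := fun h => hpm (Nat.dvd_of_mem_primeFactors h)
    have hfac : (p ^ k * m).factorization = Finsupp.single p k + m.factorization := by
      rw [Nat.factorization_mul (pow_ne_zero _ hp.ne_zero) hm, hp.factorization_pow]
    have hprimes : (p ^ k * m).primeFactors = insert p m.primeFactors := by
      rw [Nat.primeFactors_mul (pow_ne_zero _ hp.ne_zero) hm,
        Nat.primeFactors_prime_pow hk.ne' hp, Finset.insert_eq]
    have hp_fac : (p ^ k * m).factorization p = k := by
      simp [hfac, Nat.factorization_eq_zero_of_not_dvd hpm]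
    have hq : ∏ q ∈ m.primeFactors, ∑' j, f (q ^ (j + (p ^ k * m).factorization q)) =
        ∏ q ∈ m.primeFactors, ∑' j, f (q ^ (j + m.factorization q)) := by
      refine Finset.prod_congr rfl fun q hq => ?_
      have hqp : p ≠ q := fun h => hpf (h ▸ hq)
      simp [hfac, Finsupp.single_eq_of_ne' hqp]
    have hsplit := hf.tsum_mul_prime_pow_mul hsum hp hpm k
    have hsplit₀ := hf.tsum_mul_prime_pow_mul hsum hp hpm 0
    simp only [pow_zero, one_mul, add_zero] at hsplit₀
    have ih := ih hm
    rw [hprimes, Finset.prod_insert hpf, Finset.prod_insert hpf, hp_fac, hq, hsplit]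
    rw [hsplit₀] at ih
    linear_combination (∑' j, f (p ^ (j + k))) * ih

end EulerFactors

end ArithmeticFunction

open ArithmeticFunction

lemma zetaShift_apply (α : ℂ) {n : ℕ} (hn : n ≠ 0) : zetaShift α n = (n : ℂ) ^ (-α) := if_neg hn

lemma muShift_apply (γ : ℂ) {n : ℕ} (hn : n ≠ 0) :
    muShift γ n = (moebius n : ℂ) * (n : ℂ) ^ (-γ) := if_neg hn

lemma zetaShift_pow (α : ℂ) {p : ℕ} (hp : p ≠ 0) (j : ℕ) :
    zetaShift α (p ^ j) = ((p : ℂ) ^ (-α)) ^ j := by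
  rw [zetaShift_apply α (pow_ne_zero j hp), Nat.cast_pow, ← natCast_cpow_natCast_mul, cpow_nat_mul]

lemma isMultiplicative_zetaShift (α : ℂ) : (zetaShift α).IsMultiplicative := by
  refine IsMultiplicative.iff_ne_zero.2 ⟨by simp [zetaShift_apply], fun {m n} hm hn _ => ?_⟩
  rw [zetaShift_apply α (mul_ne_zero hm hn), zetaShift_apply α hm, zetaShift_apply α hn,
    Nat.cast_mul, natCast_mul_natCast_cpow]

lemma isMultiplicative_muShift (γ : ℂ) : (muShift γ).IsMultiplicative := by
  refine IsMultiplicative.iff_ne_zero.2 ⟨by simp [muShift_apply], fun {m n} hm hn h => ?_⟩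
  rw [muShift_apply γ (mul_ne_zero hm hn), muShift_apply γ hm, muShift_apply γ hn,
    Nat.cast_mul, natCast_mul_natCast_cpow, isMultiplicative_moebius.map_mul_of_coprime h]
  push_cast
  ring

lemma isMultiplicative_multiset_prod {ι : Type*} {g : ι → ArithmeticFunction ℂ}
    (hg : ∀ i, (g i).IsMultiplicative) (s : Multiset ι) : (s.map g).prod.IsMultiplicative := by
  induction s using Multiset.induction_on with
  | empty => exact isMultiplicative_one
  | cons i s ih => simpa using (hg i).mul ih

lemma isMultiplicative_Ifun (A C : Multiset ℂ) : (Ifun A C).IsMultiplicative :=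
  (isMultiplicative_multiset_prod isMultiplicative_zetaShift A).mul
    (isMultiplicative_multiset_prod isMultiplicative_muShift C)

lemma term_mul_natCast_cpow (f : ℕ → ℂ) (w α : ℂ) (n : ℕ) :
    LSeries.term (fun n => f n * (n : ℂ) ^ (-α)) w n = LSeries.term f (w + α) n := by
  rcases eq_or_ne n 0 with rfl | hn
  · simp
  · rw [LSeries.term_of_ne_zero hn, LSeries.term_of_ne_zero hn,
      cpow_add _ _ (Nat.cast_ne_zero.2 hn), cpow_neg]
    field_simp

lemma LSeriesHasSum_zetaShift {w α : ℂ} (h : 1 < (w + α).re) :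
    LSeriesHasSum ↗(zetaShift α) w (riemannZeta (w + α)) := by
  refine (LSeriesHasSum_congr w (f := fun n => (1 : ℕ → ℂ) n * (n : ℂ) ^ (-α)) _
    fun hn => by simp [zetaShift_apply α hn]).1 ?_
  unfold LSeriesHasSum
  rw [funext (term_mul_natCast_cpow 1 w α)]
  exact LSeriesHasSum_one h

lemma LSeriesHasSum_muShift {w γ : ℂ} (h : 1 < (w + γ).re) :
    LSeriesHasSum ↗(muShift γ) w (riemannZeta (w + γ))⁻¹ := by
  refine (LSeriesHasSum_congr w (f := fun n => (moebius n : ℂ) * (n : ℂ) ^ (-γ)) _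
    fun hn => by simp [muShift_apply γ hn]).1 ?_
  have hL : L ↗moebius (w + γ) = (riemannZeta (w + γ))⁻¹ := by
    refine eq_inv_of_mul_eq_one_right ?_
    rw [← LSeries_zeta_eq_riemannZeta h]
    exact LSeries_zeta_mul_Lseries_moebius h
  unfold LSeriesHasSum
  rw [funext (term_mul_natCast_cpow _ w γ), ← hL]
  exact (LSeriesSummable_moebius_iff.2 h).LSeriesHasSum

lemma LSeriesHasSum_multiset_prod {ι : Type*} {g : ι → ArithmeticFunction ℂ} {a : ι → ℂ} {w : ℂ}
    {s : Multiset ι} (h : ∀ i ∈ s, LSeriesHasSum ↗(g i) w (a i)) :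
    LSeriesHasSum ↗(s.map g).prod w (s.map a).prod := by
  induction s using Multiset.induction_on with
  | empty =>
    have hδ : LSeriesHasSum δ w 1 := by
      unfold LSeriesHasSum
      simp_rw [funext (LSeries.term_delta w)]
      exact hasSum_ite_eq 1 1
    simpa [one_eq_delta] using hδ
  | cons i s ih =>
    rw [Multiset.map_cons, Multiset.prod_cons, Multiset.map_cons, Multiset.prod_cons]
    exact LSeriesHasSum_mul (h i (Multiset.mem_cons_self i s))
      (ih fun j hj => h j (Multiset.mem_cons_of_mem hj))

lemma LSeriesHasSum_Ifun {A C : Multiset ℂ} {w : ℂ}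
    (hA : ∀ α ∈ A, 1 < (w + α).re) (hC : ∀ γ ∈ C, 1 < (w + γ).re) :
    LSeriesHasSum ↗(Ifun A C) w ((A.map fun α => riemannZeta (w + α)).prod /
      (C.map fun γ => riemannZeta (w + γ)).prod) := by
  rw [div_eq_mul_inv, ← Multiset.prod_map_inv]
  exact LSeriesHasSum_mul (LSeriesHasSum_multiset_prod fun α hα => LSeriesHasSum_zetaShift (hA α hα))
    (LSeriesHasSum_multiset_prod fun γ hγ => LSeriesHasSum_muShift (hC γ hγ))

theorem stmt8 (A C : Multiset ℂ) (w : ℂ)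
    (hA : ∀ α ∈ A, 1 < (w + α).re) (hC : ∀ γ ∈ C, 1 < (w + γ).re)
    (r : ℕ) (hr : 0 < r) :
    (Summable fun n : ℕ => ‖Ifun A C (n * r) * (n : ℂ) ^ (-w)‖) ∧
    (∀ p ∈ r.primeFactors, Summable fun j : ℕ => ‖Ifun A C (p ^ j) * ((p : ℂ) ^ (-w)) ^ j‖) ∧
    (∀ p ∈ r.primeFactors,
      Summable fun j : ℕ => ‖Ifun A C (p ^ (j + r.factorization p)) * ((p : ℂ) ^ (-w)) ^ j‖) ∧
    (∑' n : ℕ, Ifun A C (n * r) * (n : ℂ) ^ (-w)) *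
        ∏ p ∈ r.primeFactors, ∑' j : ℕ, Ifun A C (p ^ j) * ((p : ℂ) ^ (-w)) ^ j =
      ((A.map fun α => riemannZeta (w + α)).prod /
          (C.map fun γ => riemannZeta (w + γ)).prod) *
        ∏ p ∈ r.primeFactors,
          ∑' j : ℕ, Ifun A C (p ^ (j + r.factorization p)) * ((p : ℂ) ^ (-w)) ^ j := by
  set f : ArithmeticFunction ℂ := (Ifun A C).pmul (zetaShift w) with hf_def
  have hf : f.IsMultiplicative := (isMultiplicative_Ifun A C).pmul (isMultiplicative_zetaShift w)
  have hf_sum : HasSum f ((A.map fun α => riemannZeta (w + α)).prod /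
      (C.map fun γ => riemannZeta (w + γ)).prod) := by
    have h := LSeriesHasSum_Ifun hA hC
    unfold LSeriesHasSum at h
    convert h using 1
    ext n
    rcases eq_or_ne n 0 with rfl | hn
    · simp
    · rw [LSeries.term_of_ne_zero hn, hf_def, pmul_apply, zetaShift_apply w hn, cpow_neg,
        div_eq_mul_inv]
  have hf_norm : Summable fun n => ‖f n‖ := hf_sum.summable.norm
  have hr0 : r ≠ 0 := hr.ne'
  have hpow {p : ℕ} (hp : p ≠ 0) : (p : ℂ) ^ (-w) ≠ 0 := by
    simp [cpow_eq_zero_iff, hp]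
  have hmult (n : ℕ) :
      Ifun A C (n * r) * (n : ℂ) ^ (-w) = ((r : ℂ) ^ (-w))⁻¹ * f (n * r) := by
    rcases eq_or_ne n 0 with rfl | hn
    · simp
    · rw [hf_def, pmul_apply, zetaShift_apply w (mul_ne_zero hn hr0), Nat.cast_mul,
        natCast_mul_natCast_cpow]
      have := hpow hr0
      field_simp
  have hlocal {p : ℕ} (hp : p ≠ 0) (v j : ℕ) : Ifun A C (p ^ (j + v)) * ((p : ℂ) ^ (-w)) ^ j =
      (((p : ℂ) ^ (-w)) ^ v)⁻¹ * f (p ^ (j + v)) := by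
    rw [hf_def, pmul_apply, zetaShift_pow w hp, pow_add ((p : ℂ) ^ (-w))]
    have := hpow hp
    field_simp
  have hlocal₀ {p : ℕ} (hp : p ≠ 0) (j : ℕ) :
      Ifun A C (p ^ j) * ((p : ℂ) ^ (-w)) ^ j = f (p ^ j) := by
    simpa using hlocal hp 0 j
  have hlocal_sum {p : ℕ} (hp : p ∈ r.primeFactors) (v : ℕ) :
      Summable fun j => ‖f (p ^ (j + v))‖ :=
    hf_norm.comp_injective ((Nat.pow_right_injective
      (Nat.prime_of_mem_primeFactors hp).two_le).comp (add_left_injective v))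
  have hne {p : ℕ} (hp : p ∈ r.primeFactors) : p ≠ 0 := (Nat.prime_of_mem_primeFactors hp).ne_zero
  refine ⟨?_, fun p hp => ?_, fun p hp => ?_, ?_⟩
  · simp_rw [hmult, norm_mul]
    exact (hf_norm.comp_injective (mul_left_injective₀ hr0)).mul_left _
  · simp_rw [hlocal₀ (hne hp)]
    exact hlocal_sum hp 0
  · simp_rw [hlocal (hne hp), norm_mul]
    exact (hlocal_sum hp _).mul_left _
  · have hr_pow : ∏ p ∈ r.primeFactors, (((p : ℂ) ^ (-w)) ^ r.factorization p)⁻¹ =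
        ((r : ℂ) ^ (-w))⁻¹ := by
      rw [Finset.prod_inv_distrib, ← zetaShift_apply w hr0,
        (isMultiplicative_zetaShift w).multiplicative_factorization _ hr0]
      exact congrArg _ (Finset.prod_congr rfl fun p hp => (zetaShift_pow w (hne hp) _).symm)
    have h₀ : ∏ p ∈ r.primeFactors, ∑' j : ℕ, Ifun A C (p ^ j) * ((p : ℂ) ^ (-w)) ^ j =
        ∏ p ∈ r.primeFactors, ∑' j, f (p ^ j) :=
      Finset.prod_congr rfl fun p hp => tsum_congr (hlocal₀ (hne hp))
    have h₁ : ∏ p ∈ r.primeFactors,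
          ∑' j : ℕ, Ifun A C (p ^ (j + r.factorization p)) * ((p : ℂ) ^ (-w)) ^ j =
        ((r : ℂ) ^ (-w))⁻¹ * ∏ p ∈ r.primeFactors, ∑' j, f (p ^ (j + r.factorization p)) := by
      rw [← hr_pow, ← Finset.prod_mul_distrib]
      refine Finset.prod_congr rfl fun p hp => ?_
      rw [← tsum_mul_left]
      exact tsum_congr (hlocal (hne hp) _)
    rw [h₀, h₁, tsum_congr hmult, tsum_mul_left, mul_assoc,
      hf.tsum_mul_prod_primeFactors hf_norm hr0, hf_sum.tsum_eq]
    ring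
end

section
/- Let q be a positive integer and let s be a complex number with Re(s) > 1. Define the Ramanujan sum r_q(h) = ∑_{d | gcd(q,h)} d · μ(q/d) for positive integers h, where μ is the Möbius function. Then the series ∑_{h=1}^{∞} r_q(h) h^{-s} converges absolutely and equals ζ(s) · q^{1-s} · ∏_{p | q} (1 − p^{s-1}), where the product runs over the prime divisors p of q and ζ is the Riemann zeta function. -/
open scoped BigOperators

/-- The Ramanujan sum `r_q(h) = ∑_{d | gcd(q,h)} d · μ(q/d)`. -/
noncomputable def ramanujanSum (q h : ℕ) : ℂ :=
  ∑ d ∈ (Nat.gcd q h).divisors, (d : ℂ) * (ArithmeticFunction.moebius (q / d) : ℂ)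

theorem ArithmeticFunction.IsMultiplicative.sum_moebius_mul_eq_prod_one_sub {R : Type*}
    [CommRing R] {f : ArithmeticFunction R} (hf : f.IsMultiplicative) {n : ℕ} (hn : n ≠ 0) :
    ∑ d ∈ n.divisors, (ArithmeticFunction.moebius d : R) * f d =
      ∏ p ∈ n.primeFactors, (1 - f p) := by
  have hrad : Squarefree (∏ p ∈ n.primeFactors, p) := by
    rw [← Nat.radical_eq_prod_primeFactors]
    exact UniqueFactorizationMonoid.squarefree_radical
  have hprod := ArithmeticFunction.IsMultiplicative.prodPrimeFactors_one_sub_of_squarefree f hf hrad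
  rw [Nat.primeFactors_prod_primeFactors] at hprod
  rw [hprod]
  symm
  refine Finset.sum_subset
    (Nat.divisors_subset_of_dvd hn (Nat.prod_primeFactors_dvd n)) fun d hd hd' => ?_
  have hsq : ¬ Squarefree d := fun h => hd' <| Nat.mem_divisors.2 ⟨by
    rw [← Nat.prod_primeFactors_of_squarefree h]
    exact Finset.prod_dvd_prod_of_subset _ _ _
      (Nat.primeFactors_mono (Nat.dvd_of_mem_divisors hd) hn), hrad.ne_zero⟩
  rw [ArithmeticFunction.moebius_eq_zero_of_not_squarefree hsq, Int.cast_zero, zero_mul]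

theorem sum_moebius_mul_cpow {n : ℕ} (hn : n ≠ 0) {w : ℂ} (hw : w ≠ 0) :
    ∑ d ∈ n.divisors, (ArithmeticFunction.moebius d : ℂ) * (d : ℂ) ^ w =
      ∏ p ∈ n.primeFactors, (1 - (p : ℂ) ^ w) := by
  let f : ArithmeticFunction ℂ := ⟨fun n => (n : ℂ) ^ w, by simp [hw]⟩
  have hf : f.IsMultiplicative := by
    refine ⟨by simp [f], fun {a b} _ => ?_⟩
    simp only [f, ArithmeticFunction.coe_mk, Nat.cast_mul]
    exact Complex.natCast_mul_natCast_cpow a b w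
  exact hf.sum_moebius_mul_eq_prod_one_sub hn

theorem ramanujanSum_eq_sum_ite {q : ℕ} (hq : q ≠ 0) (h : ℕ) :
    ramanujanSum q h = ∑ d ∈ q.divisors,
      if d ∣ h then (d : ℂ) * (ArithmeticFunction.moebius (q / d) : ℂ) else 0 := by
  rw [ramanujanSum, ← Finset.sum_filter]
  congr 1
  ext d
  simp [Nat.dvd_gcd_iff, hq]

theorem hasSum_cpow_neg {s : ℂ} (hs : 1 < s.re) :
    HasSum (fun n : ℕ => (n : ℂ) ^ (-s)) (riemannZeta s) := by
  have hsum : Summable fun n : ℕ => 1 / (n : ℂ) ^ s := Complex.summable_one_div_nat_cpow.2 hs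
  simpa [zeta_eq_tsum_one_div_nat_cpow hs, Complex.cpow_neg] using hsum.hasSum

theorem hasSum_ite_dvd_cpow_neg {s : ℂ} (hs : 1 < s.re) {d : ℕ} (hd : d ≠ 0) :
    HasSum (fun h : ℕ => if d ∣ h then (h : ℂ) ^ (-s) else 0)
      ((d : ℂ) ^ (-s) * riemannZeta s) := by
  have hinj : Function.Injective fun n : ℕ => d * n := mul_right_injective₀ hd
  rw [← hinj.hasSum_iff]
  · have hmul := (hasSum_cpow_neg hs).mul_left ((d : ℂ) ^ (-s))
    refine (congrArg (HasSum · _) (funext fun n => ?_)).mpr hmul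
    simp [Complex.natCast_mul_natCast_cpow]
  · intro h hh
    rw [if_neg]
    rintro ⟨n, rfl⟩
    exact hh ⟨n, rfl⟩

theorem hasSum_ramanujanSum_mul_cpow_neg {q : ℕ} (hq : q ≠ 0) {s : ℂ} (hs : 1 < s.re) :
    HasSum (fun h : ℕ => ramanujanSum q h * (h : ℂ) ^ (-s))
      (∑ d ∈ q.divisors, (d : ℂ) * (ArithmeticFunction.moebius (q / d) : ℂ) *
        ((d : ℂ) ^ (-s) * riemannZeta s)) := by
  have hterm := hasSum_sum (s := q.divisors) fun d hd =>
    (hasSum_ite_dvd_cpow_neg hs (Nat.pos_of_mem_divisors hd).ne').mul_left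
      ((d : ℂ) * (ArithmeticFunction.moebius (q / d) : ℂ))
  refine (congrArg (HasSum · _) (funext fun h => ?_)).mpr hterm
  rw [ramanujanSum_eq_sum_ite hq, Finset.sum_mul]
  exact Finset.sum_congr rfl fun d _ => by split_ifs <;> simp

theorem sum_divisors_mul_moebius_mul_cpow_neg {q : ℕ} (hq : q ≠ 0) {s : ℂ} (hs : s ≠ 1) :
    ∑ d ∈ q.divisors, (d : ℂ) * (ArithmeticFunction.moebius (q / d) : ℂ) * (d : ℂ) ^ (-s) =
      (q : ℂ) ^ (1 - s) * ∏ p ∈ q.primeFactors, (1 - (p : ℂ) ^ (s - 1)) := by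
  rw [← sum_moebius_mul_cpow hq (sub_ne_zero.2 hs), Finset.mul_sum,
    ← Nat.sum_div_divisors q fun e => (q : ℂ) ^ (1 - s) *
      ((ArithmeticFunction.moebius e : ℂ) * (e : ℂ) ^ (s - 1))]
  refine Finset.sum_congr rfl fun d hd => ?_
  obtain ⟨e, rfl⟩ := Nat.dvd_of_mem_divisors hd
  have hd0 : d ≠ 0 := left_ne_zero_of_mul hq
  have he0 : e ≠ 0 := right_ne_zero_of_mul hq
  have hdC : (d : ℂ) ≠ 0 := Nat.cast_ne_zero.2 hd0
  have heC : (e : ℂ) ≠ 0 := Nat.cast_ne_zero.2 he0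
  have hcancel : (e : ℂ) ^ (1 - s) * (e : ℂ) ^ (s - 1) = 1 := by
    rw [← Complex.cpow_add _ _ heC]
    simp
  have hdpow : (d : ℂ) ^ (1 - s) = d * (d : ℂ) ^ (-s) := by
    rw [sub_eq_add_neg, Complex.cpow_add _ _ hdC, Complex.cpow_one]
  rw [Nat.mul_div_cancel_left e (Nat.pos_of_ne_zero hd0), Nat.cast_mul,
    Complex.natCast_mul_natCast_cpow, hdpow]
  linear_combination
    -((d : ℂ) * (d : ℂ) ^ (-s) * (ArithmeticFunction.moebius e : ℂ)) * hcancel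

/-- `∑_{h≥1} r_q(h) h^{-s} = ζ(s) q^{1-s} ∏_{p|q} (1 − p^{s-1})` for `Re s > 1`,
the series converging absolutely.  (The `h = 0` term of the `tsum` vanishes since
`(0 : ℂ) ^ (-s) = 0`.) -/
theorem stmt9 (q : ℕ) (hq : 0 < q) (s : ℂ) (hs : 1 < s.re) :
    (Summable fun h : ℕ => ‖ramanujanSum q h * (h : ℂ) ^ (-s)‖) ∧
    (∑' h : ℕ, ramanujanSum q h * (h : ℂ) ^ (-s)) =
      riemannZeta s * (q : ℂ) ^ (1 - s) * ∏ p ∈ q.primeFactors, (1 - (p : ℂ) ^ (s - 1)) := by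
  have hsum := hasSum_ramanujanSum_mul_cpow_neg hq.ne' hs
  have hs1 : s ≠ 1 := by
    rintro rfl
    simp at hs
  refine ⟨hsum.summable.norm, ?_⟩
  rw [hsum.tsum_eq, mul_assoc, ← sum_divisors_mul_moebius_mul_cpow_neg hq.ne' hs1, Finset.mul_sum]
  exact Finset.sum_congr rfl fun d _ => by ring
end

section
/- Let s be a complex number with Re(s) > 2. Then the function t ↦ 1/((2 + it)(s − 2 − it)) is integrable on ℝ and (1/(2π)) ∫_{-∞}^{∞} dt / ((2 + it)(s − 2 − it)) = 1/s. (This is the contour-integral identity (1/(2πi)) ∫_{Re z = 2} dz/(z(s − z)) = 1/s.) -/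
open MeasureTheory Complex

/-- On a vertical line off the imaginary axis, `|z|⁻²` is integrable. -/
lemma integrable_inv_normSq_add_mul_I {a : ℂ} (ha : a.re ≠ 0) :
    Integrable (fun t : ℝ => (normSq (a + t * I))⁻¹) := by
  have h := (((integrable_inv_one_add_sq.comp_div ha).comp_add_right a.im).const_mul
    (a.re ^ 2)⁻¹)
  refine h.congr (Filter.Eventually.of_forall fun t => ?_)
  simp only [normSq_apply, add_re, add_im, mul_re, mul_im, ofReal_re, ofReal_im, I_re, I_im]
  rw [← mul_inv]
  congr 1
  field_simp
  ring

/-- On a vertical line, `1 / (z w)` with `z + w` constant is integrable away from the poles. -/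
lemma integrable_one_div_add_mul_sub {a b : ℂ} (ha : 0 < a.re) (hb : 0 < b.re) :
    Integrable (fun t : ℝ => 1 / ((a + t * I) * (b - t * I))) := by
  have h2 := (integrable_inv_normSq_add_mul_I hb.ne').comp_neg
  refine ((integrable_inv_normSq_add_mul_I ha.ne').add h2).mono'
    (Measurable.aestronglyMeasurable (by fun_prop)) (Filter.Eventually.of_forall fun t => ?_)
  have e : b + ((-t : ℝ) : ℂ) * I = b - t * I := by push_cast; ring
  simp only [Pi.add_apply, e, normSq_eq_norm_sq, norm_mul, one_div, mul_inv, norm_inv,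
    ← inv_pow]
  nlinarith [sq_nonneg (‖a + t * I‖⁻¹ - ‖b - t * I‖⁻¹), sq_nonneg ‖a + t * I‖⁻¹,
    sq_nonneg ‖b - t * I‖⁻¹]

lemma tendsto_log_add_sub_log_sub {a b c : ℂ} (hc : c ∈ slitPlane) (hc' : -c ∈ slitPlane) :
    Filter.Tendsto (fun t : ℝ => log (a + t * c) - log (b - t * c)) Filter.atTop
      (nhds (log c - log (-c))) := by
  have hinv : Filter.Tendsto (fun t : ℝ => ((t⁻¹ : ℝ) : ℂ)) Filter.atTop (nhds 0) := by
    simpa [Function.comp_def] using (continuous_ofReal.tendsto 0).comp tendsto_inv_atTop_zero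
  have key : ∀ d w : ℂ, Filter.Tendsto (fun t : ℝ => ((t⁻¹ : ℝ) : ℂ) * d + w) Filter.atTop
      (nhds w) := fun d w => by simpa using (hinv.mul_const d).add_const w
  refine (((key a c).clog hc).sub ((key b (-c)).clog hc')).congr' ?_
  filter_upwards [Filter.eventually_gt_atTop 0,
    (key a c).eventually_ne (slitPlane_ne_zero hc),
    (key b (-c)).eventually_ne (slitPlane_ne_zero hc')] with t ht h1 h2
  have ht' : (t : ℂ) ≠ 0 := by exact_mod_cast ht.ne'
  have e1 : a + t * c = t * (((t⁻¹ : ℝ) : ℂ) * a + c) := by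
    push_cast; field_simp
  have e2 : b - t * c = t * (((t⁻¹ : ℝ) : ℂ) * b + -c) := by
    push_cast; field_simp; ring
  rw [e1, e2, log_ofReal_mul ht h1, log_ofReal_mul ht h2]
  ring

lemma hasDerivAt_log_add_sub_log_sub {a b : ℂ} (ha : 0 < a.re) (hb : 0 < b.re) (t : ℝ) :
    HasDerivAt (fun t : ℝ => log (a + t * I) - log (b - t * I))
      ((a + b) * I * (1 / ((a + t * I) * (b - t * I)))) t := by
  have hz : a + t * I ∈ slitPlane := Or.inl (by simpa using ha)
  have hw : b - t * I ∈ slitPlane := Or.inl (by simpa using hb)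
  have h0 : HasDerivAt (fun t : ℝ => (t : ℂ) * I) I t := by
    simpa using (HasDerivAt.ofReal_comp (hasDerivAt_id t)).mul_const I
  refine (((h0.const_add a).clog_real hz).sub ((h0.const_sub b).clog_real hw)).congr_deriv ?_
  have hz0 := slitPlane_ne_zero hz
  have hw0 := slitPlane_ne_zero hw
  rw [div_sub_div _ _ hz0 hw0, mul_one_div]
  ring

/-- The contour-integral identity `(1/(2πi)) ∫_{Re z = 2} dz/(z(s−z)) = 1/s` for `Re s > 2`,
written as an integral over the real parametrization `z = 2 + it`. -/
theorem stmt12 (s : ℂ) (hs : 2 < s.re) :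
    Integrable (fun t : ℝ => 1 / ((2 + t * I) * (s - 2 - t * I))) ∧
    (1 / (2 * (Real.pi : ℂ))) * ∫ t : ℝ, 1 / ((2 + t * I) * (s - 2 - t * I)) = 1 / s := by
  have ha : 0 < (2 : ℂ).re := by simp
  have hb : 0 < (s - 2).re := by simpa using hs
  have hint := integrable_one_div_add_mul_sub ha hb
  refine ⟨hint, ?_⟩
  have hI : I ∈ slitPlane := Or.inr (by simp)
  have hI' : -I ∈ slitPlane := Or.inr (by simp)
  have htop := tendsto_log_add_sub_log_sub (a := 2) (b := s - 2) hI hI'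
  have hbot : Filter.Tendsto (fun t : ℝ => log (2 + t * I) - log (s - 2 - t * I)) Filter.atBot
      (nhds (log (-I) - log I)) := by
    have h := (tendsto_log_add_sub_log_sub (a := 2) (b := s - 2) (c := -I) hI'
      (by simpa using hI)).comp Filter.tendsto_neg_atBot_atTop
    simpa [Function.comp_def, sub_eq_add_neg] using h
  have h := integral_of_hasDerivAt_of_tendsto (hasDerivAt_log_add_sub_log_sub ha hb)
    (hint.const_mul _) hbot htop
  rw [integral_const_mul, log_I, log_neg_I] at h
  have hs0 : s ≠ 0 := by
    rintro rfl
    norm_num at hs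
  have hpi : (Real.pi : ℂ) ≠ 0 := ofReal_ne_zero.2 Real.pi_ne_zero
  have h' : s * ∫ t : ℝ, 1 / ((2 + t * I) * (s - 2 - t * I)) = 2 * Real.pi := by
    apply mul_right_cancel₀ I_ne_zero
    linear_combination h
  rw [eq_div_iff hs0, mul_assoc, mul_comm _ s, h']
  field_simp
end

section
/- Let ψ : ℝ → ℂ be a smooth function with compact support contained in the open half-line (0, ∞), and define its Fourier transform ψ̂(x) = ∫_{-∞}^{∞} ψ(t) e^{-2πixt} dt. Let A be a complex number with 0 < Re(A) < 1, and let χ(s) = 2^s π^{s-1} sin(πs/2) Γ(1−s). Then ∫_{0}^{∞} (ψ̂(v) + ψ̂(−v)) v^{A-1} dv = χ(1−A) · ∫_{0}^{∞} ψ(t) t^{-A} dt, with both integrals absolutely convergent. -/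
open MeasureTheory Complex Real

/-- The integrand of the Laplace transform of `t ^ (a - 1)` is integrable on `(0, ∞)`. -/
theorem integrableOn_cpow_mul_exp_neg_mul_Ioi {a r : ℂ} (ha : 0 < a.re) (hr : 0 < r.re) :
    IntegrableOn (fun t : ℝ => (t : ℂ) ^ (a - 1) * Complex.exp (-(r * t))) (Set.Ioi 0) := by
  have hb := integrableOn_rpow_mul_exp_neg_mul_rpow (s := a.re - 1) (p := 1) (b := r.re)
    (by linarith) one_pos hr
  refine Integrable.mono' hb ?_ ?_
  · refine ContinuousOn.aestronglyMeasurable (fun t ht => ?_) measurableSet_Ioi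
    have : (t : ℂ) ∈ slitPlane := Or.inl (by simpa using ht)
    exact (((continuousAt_ofReal_cpow_const t _ (Or.inr ht.ne')).mul
      (by fun_prop))).continuousWithinAt
  · filter_upwards [ae_restrict_mem measurableSet_Ioi] with t ht
    rw [norm_mul, norm_cpow_eq_rpow_re_of_pos ht, Complex.norm_exp]
    simp

/-- The Laplace transform of `t ^ (a - 1)` on the right half-plane. -/
theorem integral_cpow_mul_exp_neg_mul_Ioi_of_re_pos {a r : ℂ} (ha : 0 < a.re) (hr : 0 < r.re) :
    ∫ t : ℝ in Set.Ioi 0, (t : ℂ) ^ (a - 1) * Complex.exp (-(r * t)) =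
      r ^ (-a) * Complex.Gamma a := by
  have hopen : IsOpen {z : ℂ | 0 < z.re} := isOpen_lt continuous_const continuous_re
  have hL : DifferentiableOn ℂ
      (fun r : ℂ => ∫ t : ℝ in Set.Ioi 0, (t : ℂ) ^ (a - 1) * Complex.exp (-(r * t)))
      {z : ℂ | 0 < z.re} := by
    intro z (hz : 0 < z.re)
    refine DifferentiableAt.differentiableWithinAt ?_
    have hmem : {w : ℂ | z.re / 2 < w.re} ∈ nhds z :=
      (isOpen_lt continuous_const continuous_re).mem_nhds (by simpa using hz)
    have hmeas (w : ℂ) (hw : 0 < w.re) : AEStronglyMeasurable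
        (fun t : ℝ => (t : ℂ) ^ (a - 1) * Complex.exp (-(w * t)))
        (volume.restrict (Set.Ioi 0)) :=
      (integrableOn_cpow_mul_exp_neg_mul_Ioi ha hw).aestronglyMeasurable
    have hb := integrableOn_rpow_mul_exp_neg_mul_rpow (s := a.re) (p := 1) (b := z.re / 2)
      (by linarith) one_pos (by linarith)
    refine (hasDerivAt_integral_of_dominated_loc_of_deriv_le hmem
      (F := fun w (t : ℝ) => (t : ℂ) ^ (a - 1) * Complex.exp (-(w * t)))
      (F' := fun w (t : ℝ) => -(t : ℂ) * ((t : ℂ) ^ (a - 1) * Complex.exp (-(w * t))))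
      ?_ (integrableOn_cpow_mul_exp_neg_mul_Ioi ha hz) ?_ ?_ hb ?_).2.differentiableAt
    · filter_upwards [hopen.mem_nhds hz] with w hw using hmeas w hw
    · exact (by fun_prop : Continuous fun t : ℝ => -(t : ℂ)).aestronglyMeasurable.mul (hmeas z hz)
    · filter_upwards [ae_restrict_mem measurableSet_Ioi] with t (ht : 0 < t) w hw
      have h1 : ‖-(t : ℂ)‖ = t := by simp [abs_of_pos ht]
      rw [norm_mul, norm_mul, norm_cpow_eq_rpow_re_of_pos ht, Complex.norm_exp, h1,
        ← mul_assoc, ← Real.rpow_one_add' ht.le (by simpa using ha.ne')]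
      have h2 : 1 + (a - 1).re = a.re := by simp
      rw [h2, Real.rpow_one]
      gcongr
      simp only [neg_re, re_mul_ofReal, neg_mul, neg_le_neg_iff]
      exact mul_le_mul_of_nonneg_right (le_of_lt hw) ht.le
    · refine Filter.Eventually.of_forall fun t w _ => ?_
      have : HasDerivAt (fun w : ℂ => -(w * t)) (-(1 * (t : ℂ))) w :=
        ((hasDerivAt_id w).mul_const _).neg
      convert! (this.cexp.const_mul ((t : ℂ) ^ (a - 1))) using 1
      ring
  have hR : DifferentiableOn ℂ (fun r : ℂ => r ^ (-a) * Complex.Gamma a) {z : ℂ | 0 < z.re} :=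
    fun z hz => ((differentiableAt_id.cpow_const (Or.inl hz)).mul_const _).differentiableWithinAt
  refine (hL.analyticOnNhd hopen).eqOn_of_preconnected_of_frequently_eq
    (hR.analyticOnNhd hopen) (convex_halfSpace_re_gt 0).isPreconnected
    (z₀ := 1) (by simp) ?_ hr
  have hto : Filter.Tendsto (fun x : ℝ => (x : ℂ)) (nhdsWithin 1 {1}ᶜ) (nhdsWithin 1 {1}ᶜ) := by
    refine tendsto_nhdsWithin_iff.mpr ⟨?_, ?_⟩
    · exact (Complex.continuous_ofReal.tendsto' 1 1 (by simp)).mono_left nhdsWithin_le_nhds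
    · filter_upwards [self_mem_nhdsWithin] with x hx
      simpa using hx
  refine hto.frequently (Filter.Eventually.frequently ?_)
  filter_upwards [nhdsWithin_le_nhds (lt_mem_nhds one_pos)] with x hx
  rw [Complex.integral_cpow_mul_exp_neg_mul_Ioi ha hx, one_div, inv_cpow _ _
    (by rw [arg_ofReal_of_nonneg hx.le]; exact pi_pos.ne), cpow_neg]

/-- The Mellin transform of a Schwartz function converges on the right half-plane. -/
theorem SchwartzMap.integrableOn_mul_cpow (f : SchwartzMap ℝ ℂ) {a : ℂ} (ha : 0 < a.re) :
    IntegrableOn (fun v : ℝ => f v * (v : ℂ) ^ (a - 1)) (Set.Ioi 0) := by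
  have h : MellinConvergent f a := by
    refine mellinConvergent_of_isBigO_rpow (a := a.re + 1) (b := 0)
      (f.continuous.locallyIntegrable.locallyIntegrableOn _) ?_ (by linarith) ?_ ha
    · refine ((f.isBigO_cocompact_rpow (-(a.re + 1))).mono atTop_le_cocompact).congr' ?_ ?_
      · rfl
      · filter_upwards [Filter.eventually_ge_atTop 0] with x hx
        rw [Real.norm_of_nonneg hx]
    · simpa using (f.continuous.tendsto 0).isBigO_one ℝ |>.mono nhdsWithin_le_nhds
  exact h.congr_fun (fun v _ => by simp [mul_comm]) measurableSet_Ioi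

/-- A continuous function with compact support in `(0, ∞)` is integrable on `(0, ∞)` against
every complex power. -/
theorem integrableOn_mul_cpow_of_tsupport_subset {ψ : ℝ → ℂ} (hψ : Continuous ψ)
    (hcpt : HasCompactSupport ψ) (hsupp : tsupport ψ ⊆ Set.Ioi 0) (b : ℂ) :
    IntegrableOn (fun t : ℝ => ψ t * (t : ℂ) ^ b) (Set.Ioi 0) := by
  have hc : Continuous fun t : ℝ => ψ t * (t : ℂ) ^ b := by
    refine continuous_of_tsupport fun t ht => ?_
    have ht0 : 0 < t := hsupp (tsupport_mul_subset_left ht)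
    exact hψ.continuousAt.mul (continuousAt_ofReal_cpow_const t b (Or.inr ht0.ne'))
  exact (hc.integrable_of_hasCompactSupport hcpt.mul_right).integrableOn

/-- The Mellin transform of `v ↦ ∫ ψ t * exp (-(w * v * t))` for purely imaginary `w ≠ 0`. -/
theorem integral_laplace_mul_cpow {ψ : ℝ → ℂ} (hψ : Continuous ψ)
    (hcpt : HasCompactSupport ψ) (hsupp : tsupport ψ ⊆ Set.Ioi 0) {w : ℂ} (hw : w ≠ 0)
    (hre : w.re = 0) {a : ℂ} (ha : 0 < a.re)
    (hint : IntegrableOn (fun v : ℝ => (∫ t : ℝ, ψ t * Complex.exp (-(w * v * t))) *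
      (v : ℂ) ^ (a - 1)) (Set.Ioi 0)) :
    ∫ v : ℝ in Set.Ioi 0, (∫ t : ℝ, ψ t * Complex.exp (-(w * v * t))) * (v : ℂ) ^ (a - 1) =
      Complex.Gamma a * w ^ (-a) * ∫ t : ℝ in Set.Ioi 0, ψ t * (t : ℂ) ^ (-a) := by
  have him : w.im ≠ 0 := fun h => hw (Complex.ext hre h)
  have hψint : IntegrableOn ψ (Set.Ioi 0) := (hψ.integrable_of_hasCompactSupport hcpt).integrableOn
  have hψ0 : ∀ t ∉ Set.Ioi (0 : ℝ), ψ t = 0 := fun t ht =>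
    image_eq_zero_of_notMem_tsupport fun h => ht (hsupp h)
  have hswap (ε : ℝ) (hε : 0 < ε) :
      ∫ v : ℝ in Set.Ioi 0, Complex.exp (-(ε * v)) *
        ((∫ t : ℝ, ψ t * Complex.exp (-(w * v * t))) * (v : ℂ) ^ (a - 1)) =
      ∫ t : ℝ in Set.Ioi 0, ψ t * ((ε + w * t) ^ (-a) * Complex.Gamma a) := by
    have hG := integrableOn_cpow_mul_exp_neg_mul_Ioi (r := ε) ha (by simpa using hε)
    have hprod : Integrable (Function.uncurry fun v t : ℝ =>
        ((v : ℂ) ^ (a - 1) * Complex.exp (-(ε * v))) * ψ t * Complex.exp (-(w * v * t)))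
        ((volume.restrict (Set.Ioi 0)).prod (volume.restrict (Set.Ioi 0))) := by
      refine (hG.mul_prod hψint).mono ((hG.mul_prod hψint).aestronglyMeasurable.mul
        (by fun_prop : Continuous fun p : ℝ × ℝ =>
          Complex.exp (-(w * p.1 * p.2))).aestronglyMeasurable) ?_
      refine Filter.Eventually.of_forall fun p => le_of_eq ?_
      simp [Function.uncurry, Complex.norm_exp, hre]
    calc
      _ = ∫ v : ℝ in Set.Ioi 0, ∫ t : ℝ in Set.Ioi 0,
          ((v : ℂ) ^ (a - 1) * Complex.exp (-(ε * v))) * ψ t * Complex.exp (-(w * v * t)) := by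
        congr 1 with v
        rw [← setIntegral_eq_integral_of_forall_compl_eq_zero (s := Set.Ioi (0 : ℝ))
          (fun t ht => by rw [hψ0 t ht, zero_mul]), ← integral_mul_const, ← integral_const_mul]
        congr 1 with t
        ring
      _ = ∫ t : ℝ in Set.Ioi 0, ∫ v : ℝ in Set.Ioi 0,
          ((v : ℂ) ^ (a - 1) * Complex.exp (-(ε * v))) * ψ t * Complex.exp (-(w * v * t)) :=
        integral_integral_swap hprod
      _ = _ := by
        congr 1 with t
        rw [← integral_cpow_mul_exp_neg_mul_Ioi_of_re_pos ha (by simpa [hre] using hε),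
          ← integral_const_mul]
        congr 1 with v
        rw [add_mul, neg_add, Complex.exp_add]
        ring_nf
  have hleft : Filter.Tendsto (fun ε : ℝ => ∫ v : ℝ in Set.Ioi 0, Complex.exp (-(ε * v)) *
        ((∫ t : ℝ, ψ t * Complex.exp (-(w * v * t))) * (v : ℂ) ^ (a - 1)))
      (nhdsWithin 0 (Set.Ioi 0)) (nhds (∫ v : ℝ in Set.Ioi 0,
        (∫ t : ℝ, ψ t * Complex.exp (-(w * v * t))) * (v : ℂ) ^ (a - 1))) := by
    refine tendsto_integral_filter_of_dominated_convergence _ ?_ ?_ hint.norm ?_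
    · exact Filter.Eventually.of_forall fun ε =>
        (by fun_prop : Continuous fun v : ℝ => Complex.exp (-(ε * v))).aestronglyMeasurable.mul
          hint.aestronglyMeasurable
    · filter_upwards [self_mem_nhdsWithin] with ε (hε : 0 < ε)
      filter_upwards [ae_restrict_mem measurableSet_Ioi] with v (hv : 0 < v)
      rw [norm_mul]
      refine mul_le_of_le_one_left (norm_nonneg _) ?_
      rw [Complex.norm_exp]
      simpa using (mul_pos hε hv).le
    · refine Filter.Eventually.of_forall fun v => ?_
      refine Filter.Tendsto.mono_left ?_ nhdsWithin_le_nhds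
      refine Continuous.tendsto' (by fun_prop) _ _ ?_
      simp
  have hright : Filter.Tendsto (fun ε : ℝ => ∫ t : ℝ in Set.Ioi 0,
        ψ t * ((ε + w * t) ^ (-a) * Complex.Gamma a))
      (nhdsWithin 0 (Set.Ioi 0)) (nhds (∫ t : ℝ in Set.Ioi 0,
        ψ t * ((w * t) ^ (-a) * Complex.Gamma a))) := by
    have hslit (ε t : ℝ) (ht : 0 < t) : (ε + w * t : ℂ) ∈ slitPlane :=
      Or.inr (by simpa using ⟨him, ht.ne'⟩)
    refine tendsto_integral_filter_of_dominated_convergence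
      (fun t => ‖ψ t * (t : ℂ) ^ (-a)‖ *
        (‖w‖ ^ (-a.re) * Real.exp (π * |a.im|) * ‖Complex.Gamma a‖)) ?_ ?_
      ((integrableOn_mul_cpow_of_tsupport_subset hψ hcpt hsupp (-a)).norm.mul_const _) ?_
    · refine Filter.Eventually.of_forall fun ε => ?_
      refine ContinuousOn.aestronglyMeasurable (fun t ht => ?_) measurableSet_Ioi
      refine (hψ.continuousAt.mul (ContinuousAt.mul ?_ continuousAt_const)).continuousWithinAt
      exact ContinuousAt.cpow (by fun_prop) continuousAt_const (hslit ε t ht)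
    · refine Filter.Eventually.of_forall fun ε => ?_
      filter_upwards [ae_restrict_mem measurableSet_Ioi] with t (ht : 0 < t)
      have hle : ‖w‖ * t ≤ ‖(ε + w * t : ℂ)‖ := by
        have h1 : ‖w‖ = |w.im| := (abs_im_eq_norm.mpr hre).symm
        have h2 := Complex.abs_im_le_norm (ε + w * t : ℂ)
        simpa [h1, abs_mul, abs_of_pos ht] using h2
      have hpow : ‖(ε + w * t : ℂ) ^ (-a)‖ ≤
          (‖w‖ * t) ^ (-a.re) * Real.exp (π * |a.im|) := by
        rw [norm_cpow_of_ne_zero (slitPlane_ne_zero (hslit ε t ht)), div_eq_mul_inv,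
          ← Real.exp_neg]
        refine mul_le_mul ?_ ?_ (Real.exp_pos _).le (by positivity)
        · exact Real.rpow_le_rpow_of_nonpos (by positivity) hle (by simpa using ha.le)
        · refine Real.exp_le_exp.mpr ((le_abs_self _).trans ?_)
          rw [abs_neg, abs_mul, neg_im, abs_neg]
          exact mul_le_mul_of_nonneg_right (abs_arg_le_pi _) (abs_nonneg _)
      rw [norm_mul, norm_mul, norm_mul, norm_cpow_eq_rpow_re_of_pos ht, neg_re]
      rw [Real.mul_rpow (norm_nonneg _) ht.le] at hpow
      calc _ ≤ ‖ψ t‖ * ((‖w‖ ^ (-a.re) * t ^ (-a.re) * Real.exp (π * |a.im|)) *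
            ‖Complex.Gamma a‖) := by gcongr
        _ = _ := by ring
    · filter_upwards [ae_restrict_mem measurableSet_Ioi] with t (ht : 0 < t)
      refine Filter.Tendsto.mono_left ?_ nhdsWithin_le_nhds
      have hpow : ContinuousAt (fun ε : ℝ => (ε + w * t : ℂ) ^ (-a)) 0 :=
        ContinuousAt.cpow (by fun_prop) continuousAt_const (hslit 0 t ht)
      simpa using ((hpow.tendsto.mul_const (Complex.Gamma a)).const_mul (ψ t))
  have heq := tendsto_nhds_unique (hleft.congr' (by
    filter_upwards [self_mem_nhdsWithin] with ε hε using hswap ε hε)) hright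
  rw [heq, ← integral_const_mul]
  refine setIntegral_congr_fun measurableSet_Ioi fun t (ht : 0 < t) => ?_
  have hmul : (w * t) ^ (-a) = w ^ (-a) * (t : ℂ) ^ (-a) := by
    have ht0 : (t : ℂ) ≠ 0 := ofReal_ne_zero.mpr ht.ne'
    rw [mul_comm w, cpow_def_of_ne_zero (mul_ne_zero ht0 hw), cpow_def_of_ne_zero hw,
      cpow_def_of_ne_zero ht0, log_ofReal_mul ht hw, ofReal_log ht.le, ← Complex.exp_add]
    ring_nf
  simp only [hmul]
  ring

/-- Euler's formula for `cos (π a / 2)` in terms of powers of `± 2πi`. -/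
theorem two_pi_I_cpow_add_neg_two_pi_I_cpow (a : ℂ) :
    (2 * π * I) ^ (-a) + (-(2 * π * I)) ^ (-a) =
      (2 * π : ℂ) ^ (-a) * (2 * Complex.cos (π * a / 2)) := by
  have h2π : (0 : ℝ) < 2 * π := by positivity
  have hne : ((2 * π : ℝ) : ℂ) ≠ 0 := ofReal_ne_zero.mpr h2π.ne'
  have key (z : ℂ) (hz : z ≠ 0) : (((2 * π : ℝ) : ℂ) * z) ^ (-a) =
      ((2 * π : ℝ) : ℂ) ^ (-a) * Complex.exp (Complex.log z * (-a)) := by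
    rw [cpow_def_of_ne_zero (mul_ne_zero hne hz), cpow_def_of_ne_zero hne,
      log_ofReal_mul h2π hz, ofReal_log h2π.le, ← Complex.exp_add]
    ring_nf
  have h1 := key I I_ne_zero
  have h2 := key (-I) (neg_ne_zero.mpr I_ne_zero)
  rw [log_I] at h1
  rw [log_neg_I] at h2
  push_cast at h1 h2
  rw [mul_neg] at h2
  rw [h1, h2, Complex.two_cos]
  ring_nf

/-- For smooth `ψ` compactly supported in `(0,∞)`, with `ψ̂(x) = ∫ ψ(t) e^{-2πixt} dt` and
`χ(s) = 2^s π^{s-1} sin(πs/2) Γ(1−s)`, if `0 < Re A < 1` then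
`∫_0^∞ (ψ̂(v) + ψ̂(−v)) v^{A-1} dv = χ(1−A) ∫_0^∞ ψ(t) t^{−A} dt`,
both integrals being absolutely convergent. -/
theorem stmt13 (ψ : ℝ → ℂ) (hsmooth : ContDiff ℝ (⊤ : ℕ∞) ψ) (hcpt : HasCompactSupport ψ)
    (hsupp : tsupport ψ ⊆ Set.Ioi 0)
    (ψhat : ℝ → ℂ)
    (hψhat : ∀ x : ℝ, ψhat x = ∫ t : ℝ, ψ t * Complex.exp (-(2 * Real.pi * I * x * t)))
    (χ : ℂ → ℂ)
    (hχ : ∀ z : ℂ, χ z = 2 ^ z * (Real.pi : ℂ) ^ (z - 1) *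
      Complex.sin (Real.pi * z / 2) * Complex.Gamma (1 - z))
    (A : ℂ) (hA0 : 0 < A.re) (hA1 : A.re < 1) :
    IntegrableOn (fun v : ℝ => (ψhat v + ψhat (-v)) * (v : ℂ) ^ (A - 1)) (Set.Ioi 0) ∧
    IntegrableOn (fun t : ℝ => ψ t * (t : ℂ) ^ (-A)) (Set.Ioi 0) ∧
    (∫ v in Set.Ioi (0 : ℝ), (ψhat v + ψhat (-v)) * (v : ℂ) ^ (A - 1)) =
      χ (1 - A) * ∫ t in Set.Ioi (0 : ℝ), ψ t * (t : ℂ) ^ (-A) := by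
  set f : SchwartzMap ℝ ℂ := hcpt.toSchwartzMap hsmooth with hf
  have hpos (v : ℝ) : FourierTransform.fourier f v =
      ∫ t : ℝ, ψ t * Complex.exp (-((2 * π * I) * v * t)) := by
    rw [SchwartzMap.fourier_coe, Real.fourier_real_eq_integral_exp_smul]
    congr 1 with t
    simp only [hf, HasCompactSupport.toSchwartzMap_toFun, smul_eq_mul]
    rw [mul_comm]
    congr 2
    push_cast
    ring
  have hneg (v : ℝ) : FourierTransformInv.fourierInv f v =
      ∫ t : ℝ, ψ t * Complex.exp (-(-(2 * π * I) * v * t)) := by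
    rw [SchwartzMap.fourierInv_coe, Real.fourierInv_eq_fourier_neg,
      Real.fourier_real_eq_integral_exp_smul]
    congr 1 with t
    simp only [hf, HasCompactSupport.toSchwartzMap_toFun, smul_eq_mul]
    rw [mul_comm]
    congr 2
    push_cast
    ring
  have hψc := hsmooth.continuous
  have hI1 := (FourierTransform.fourier f).integrableOn_mul_cpow hA0
  have hI2 := (FourierTransformInv.fourierInv f).integrableOn_mul_cpow hA0
  simp only [hpos] at hI1
  simp only [hneg] at hI2
  have hsplit (v : ℝ) : (ψhat v + ψhat (-v)) * (v : ℂ) ^ (A - 1) =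
      (∫ t : ℝ, ψ t * Complex.exp (-((2 * π * I) * v * t))) * (v : ℂ) ^ (A - 1) +
      (∫ t : ℝ, ψ t * Complex.exp (-(-(2 * π * I) * v * t))) * (v : ℂ) ^ (A - 1) := by
    rw [hψhat, hψhat, add_mul]
    simp only [ofReal_neg, mul_neg, neg_mul]
  have hw : (2 * π * I : ℂ) ≠ 0 := two_pi_I_ne_zero
  have hcoef : Complex.Gamma A * (2 * π * I) ^ (-A) + Complex.Gamma A * (-(2 * π * I)) ^ (-A) =
      χ (1 - A) := by
    have h2π : (2 * π : ℂ) ^ (-A) = 2 ^ (-A) * (π : ℂ) ^ (-A) := by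
      exact_mod_cast mul_cpow_ofReal_nonneg zero_le_two pi_pos.le (-A)
    have h2 : (2 : ℂ) ^ (1 - A) = 2 * 2 ^ (-A) := by
      rw [sub_eq_add_neg, cpow_add _ _ two_ne_zero, cpow_one]
    have hsin : Complex.sin (π * (1 - A) / 2) = Complex.cos (π * A / 2) := by
      rw [← Complex.sin_pi_div_two_sub]
      ring_nf
    rw [← mul_add, two_pi_I_cpow_add_neg_two_pi_I_cpow, hχ, h2π, h2, hsin,
      sub_sub_cancel, sub_sub_cancel_left]
    ring
  simp only [hsplit]
  refine ⟨hI1.add hI2, integrableOn_mul_cpow_of_tsupport_subset hψc hcpt hsupp (-A), ?_⟩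
  rw [integral_add hI1 hI2,
    integral_laplace_mul_cpow hψc hcpt hsupp hw (by simp) hA0 hI1,
    integral_laplace_mul_cpow hψc hcpt hsupp (neg_ne_zero.mpr hw) (by simp) hA0 hI2,
    ← add_mul, hcoef]
end

section
/- Let A' and C be finite multisets of complex numbers, let α̂ be a complex number, write A = A'∪{α̂} for the multiset A' with α̂ adjoined, let p be a prime, and let w be a complex number satisfying Re(w + α) > 0 for every α ∈ A and Re(w + γ) > 0 for every γ ∈ C. Then for every integer J ≥ 1, all series below converge absolutely and ∑_{j=0}^{∞} I_{A,C}(p^{j+J}) p^{-jw} − p^{-α̂} ∑_{j=0}^{∞} I_{A,C}(p^{j+J-1}) p^{-jw} = ∑_{j=0}^{∞} I_{A',C}(p^{j+J}) p^{-jw}. -/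
open scoped BigOperators

theorem ArithmeticFunction.mul_apply_prime_pow {R : Type*} [Semiring R]
    (f g : ArithmeticFunction R) {p : ℕ} (hp : p.Prime) (k : ℕ) :
    (f * g) (p ^ k) = ∑ x ∈ Finset.HasAntidiagonal.antidiagonal k, f (p ^ x.1) * g (p ^ x.2) := by
  rw [ArithmeticFunction.mul_apply, Nat.sum_divisorsAntidiagonal fun a b => f a * g b,
    Nat.sum_divisors_prime_pow hp,
    Finset.Nat.sum_antidiagonal_eq_sum_range_succ fun a b => f (p ^ a) * g (p ^ b)]
  refine Finset.sum_congr rfl fun i hi => ?_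
  rw [Nat.pow_div (Nat.lt_succ_iff.mp (Finset.mem_range.mp hi)) hp.pos]

theorem zetaShift_prime_pow (α : ℂ) {p : ℕ} (hp : p.Prime) (k : ℕ) :
    zetaShift α (p ^ k) = ((p : ℂ) ^ (-α)) ^ k := by
  have h : p ^ k ≠ 0 := pow_ne_zero k hp.ne_zero
  simp only [zetaShift, ArithmeticFunction.coe_mk, if_neg h, Nat.cast_pow]
  rw [← Complex.natCast_cpow_natCast_mul, ← Complex.cpow_nat_mul]

theorem norm_cpow_neg_mul_cpow_neg_lt_one {α w : ℂ} (h : 0 < (w + α).re) {p : ℕ}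
    (hp : p.Prime) : ‖(p : ℂ) ^ (-α) * (p : ℂ) ^ (-w)‖ < 1 := by
  rw [← Complex.cpow_add _ _ (Nat.cast_ne_zero.mpr hp.ne_zero),
    Complex.norm_natCast_cpow_of_pos hp.pos]
  refine Real.rpow_lt_one_of_one_lt_of_neg (Nat.one_lt_cast.mpr hp.one_lt) ?_
  simp only [Complex.add_re, Complex.neg_re] at h ⊢
  linarith

theorem summable_norm_zetaShift {α w : ℂ} (h : 0 < (w + α).re) {p : ℕ} (hp : p.Prime) :
    Summable fun j : ℕ => ‖zetaShift α (p ^ j) * ((p : ℂ) ^ (-w)) ^ j‖ := by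
  simp only [zetaShift_prime_pow α hp, ← mul_pow, norm_pow]
  exact summable_geometric_of_lt_one (norm_nonneg _) (norm_cpow_neg_mul_cpow_neg_lt_one h hp)

theorem summable_norm_muShift (γ x : ℂ) {p : ℕ} (hp : p.Prime) :
    Summable fun j : ℕ => ‖muShift γ (p ^ j) * x ^ j‖ := by
  refine summable_of_ne_finset_zero (s := Finset.range 2) fun j hj => ?_
  have hj2 : 1 < j := by simpa using hj
  have hμ : ArithmeticFunction.moebius (p ^ j) = 0 := by
    rw [ArithmeticFunction.moebius_apply_prime_pow hp (by omega), if_neg (by omega)]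
  simp [muShift, hμ]

theorem summable_norm_mul_prime_pow {f g : ArithmeticFunction ℂ} {x : ℂ} {p : ℕ}
    (hp : p.Prime) (hf : Summable fun j : ℕ => ‖f (p ^ j) * x ^ j‖)
    (hg : Summable fun j : ℕ => ‖g (p ^ j) * x ^ j‖) :
    Summable fun j : ℕ => ‖(f * g) (p ^ j) * x ^ j‖ := by
  refine (summable_norm_sum_mul_antidiagonal_of_summable_norm hf hg).congr fun k => ?_
  rw [ArithmeticFunction.mul_apply_prime_pow f g hp, Finset.sum_mul]
  refine congrArg norm (Finset.sum_congr rfl fun y hy => ?_)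
  rw [← Finset.HasAntidiagonal.mem_antidiagonal.mp hy, pow_add]
  ring

theorem summable_norm_multiset_prod_prime_pow (s : Multiset (ArithmeticFunction ℂ)) {x : ℂ}
    {p : ℕ} (hp : p.Prime) (hs : ∀ f ∈ s, Summable fun j : ℕ => ‖f (p ^ j) * x ^ j‖) :
    Summable fun j : ℕ => ‖s.prod (p ^ j) * x ^ j‖ := by
  refine Multiset.prod_induction
    (fun f : ArithmeticFunction ℂ => Summable fun j : ℕ => ‖f (p ^ j) * x ^ j‖) s
    (fun _ _ => summable_norm_mul_prime_pow hp) ?_ hs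
  refine summable_of_ne_finset_zero (s := {0}) fun j hj => ?_
  have hj0 : j ≠ 0 := by simpa using hj
  have h : p ^ j ≠ 1 := by simp [hj0, hp.ne_one]
  simp [ArithmeticFunction.one_apply_ne h]

theorem summable_norm_Ifun {A C : Multiset ℂ} {w : ℂ} {p : ℕ} (hp : p.Prime)
    (hA : ∀ α ∈ A, 0 < (w + α).re) :
    Summable fun j : ℕ => ‖Ifun A C (p ^ j) * ((p : ℂ) ^ (-w)) ^ j‖ := by
  refine summable_norm_mul_prime_pow hp (summable_norm_multiset_prod_prime_pow _ hp ?_)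
    (summable_norm_multiset_prod_prime_pow _ hp ?_)
  · intro f hf
    obtain ⟨α, hα, rfl⟩ := Multiset.mem_map.mp hf
    exact summable_norm_zetaShift (hA α hα) hp
  · intro f hf
    obtain ⟨γ, -, rfl⟩ := Multiset.mem_map.mp hf
    exact summable_norm_muShift γ _ hp

theorem summable_norm_mul_pow_shift {𝕜 : Type*} [NormedField 𝕜] {u : ℕ → 𝕜} {x : 𝕜}
    (hx : x ≠ 0) (h : Summable fun j : ℕ => ‖u j * x ^ j‖) (m : ℕ) :
    Summable fun j : ℕ => ‖u (j + m) * x ^ j‖ := by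
  refine (((summable_nat_add_iff m).mpr h).mul_right ‖(x ^ m)⁻¹‖).congr fun j => ?_
  rw [← norm_mul, pow_add]
  congr 1
  field_simp

theorem Ifun_cons (α : ℂ) (A C : Multiset ℂ) :
    Ifun (α ::ₘ A) C = zetaShift α * Ifun A C := by
  simp [Ifun, mul_assoc]

theorem Ifun_cons_prime_pow_succ (α : ℂ) (A C : Multiset ℂ) {p : ℕ} (hp : p.Prime) (k : ℕ) :
    Ifun (α ::ₘ A) C (p ^ (k + 1)) =
      (p : ℂ) ^ (-α) * Ifun (α ::ₘ A) C (p ^ k) + Ifun A C (p ^ (k + 1)) := by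
  simp only [Ifun_cons, ArithmeticFunction.mul_apply_prime_pow _ _ hp,
    Finset.Nat.sum_antidiagonal_succ, zetaShift_prime_pow α hp, Finset.mul_sum,
    pow_succ' ((p : ℂ) ^ (-α)), pow_zero, one_mul, mul_assoc]
  rw [add_comm]

theorem stmt15 (A' C : Multiset ℂ) (αh : ℂ) (p : ℕ) (hp : p.Prime) (w : ℂ)
    (hA : ∀ α ∈ (αh ::ₘ A'), 0 < (w + α).re) (hC : ∀ γ ∈ C, 0 < (w + γ).re)
    (J : ℕ) (hJ : 1 ≤ J) :
    (Summable fun j : ℕ => ‖Ifun (αh ::ₘ A') C (p ^ (j + J)) * ((p : ℂ) ^ (-w)) ^ j‖) ∧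
    (Summable fun j : ℕ => ‖Ifun (αh ::ₘ A') C (p ^ (j + J - 1)) * ((p : ℂ) ^ (-w)) ^ j‖) ∧
    (Summable fun j : ℕ => ‖Ifun A' C (p ^ (j + J)) * ((p : ℂ) ^ (-w)) ^ j‖) ∧
    (∑' j : ℕ, Ifun (αh ::ₘ A') C (p ^ (j + J)) * ((p : ℂ) ^ (-w)) ^ j) -
        (p : ℂ) ^ (-αh) *
          ∑' j : ℕ, Ifun (αh ::ₘ A') C (p ^ (j + J - 1)) * ((p : ℂ) ^ (-w)) ^ j =
      ∑' j : ℕ, Ifun A' C (p ^ (j + J)) * ((p : ℂ) ^ (-w)) ^ j := by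
  obtain ⟨m, rfl⟩ : ∃ m, J = m + 1 := ⟨J - 1, by omega⟩
  have hx : (p : ℂ) ^ (-w) ≠ 0 := by simp [Complex.cpow_eq_zero_iff, hp.ne_zero]
  have hF := summable_norm_Ifun (C := C) hp hA
  have hG := summable_norm_Ifun (C := C) hp fun α hα => hA α (Multiset.mem_cons_of_mem hα)
  have h₁ := summable_norm_mul_pow_shift (u := fun j => Ifun (αh ::ₘ A') C (p ^ j)) hx hF (m + 1)
  have h₂ := summable_norm_mul_pow_shift (u := fun j => Ifun (αh ::ₘ A') C (p ^ j)) hx hF m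
  have h₃ := summable_norm_mul_pow_shift (u := fun j => Ifun A' C (p ^ j)) hx hG (m + 1)
  refine ⟨h₁, h₂, h₃, ?_⟩
  simp only [Nat.add_succ_sub_one]
  rw [← tsum_mul_left, ← h₁.of_norm.tsum_sub (h₂.of_norm.mul_left _)]
  refine tsum_congr fun j => ?_
  simp only [← add_assoc]
  rw [Ifun_cons_prime_pow_succ αh A' C hp]
  ring
end
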